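/- arXiv:2411.08549 — 2 statements merged into one kernel-verified Lean document; each statement's English description precedes it below -/
import Mathlib

section
/- Let γ > 0 and let X be a Cauchy random variable with scale γ. For D > 0 define Φ(D) as the infimum of the mutual information I(μ) over all probability measures μ on ℝ × ℝ whose first marginal is the law of X and which satisfy ∫ ln(1 + (x − y)²/D²) dμ(x,y) ≤ ln 4 (i.e., the CB-strength of the error X − X̂ under μ is at most D). Then Φ(D) = max{ln(γ/D), 0}. -/
open MeasureTheory Real

/-- The Cauchy law with scale `γ`: the measure on `ℝ` with density
`x ↦ γ / (π * (γ² + x²))` with respect to Lebesgue measure. -/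
noncomputable def cauchyLaw (γ : ℝ) : Measure ℝ :=
  volume.withDensity fun x => ENNReal.ofReal (γ / (π * (γ ^ 2 + x ^ 2)))

open Classical in
/-- Mutual information of a joint law `μ`: the Kullback–Leibler divergence (in nats)
of `μ` with respect to the product of its marginals, `+∞` if `μ` is not absolutely
continuous with respect to the product of the marginals or the log-likelihood ratio
is not integrable. -/
noncomputable def mutualInfo {α β : Type*} [MeasurableSpace α] [MeasurableSpace β]
    (μ : Measure (α × β)) : EReal :=
  if μ ≪ μ.fst.prod μ.snd ∧ Integrable (llr μ (μ.fst.prod μ.snd)) μ then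
    ((∫ p, llr μ (μ.fst.prod μ.snd) p ∂μ : ℝ) : EReal)
  else ⊤

open Filter Set Topology

lemma lintegral_cauchyLaw {a : ℝ} (g : ℝ → ENNReal) :
    ∫⁻ x, g x ∂(cauchyLaw a) = ∫⁻ x, ENNReal.ofReal (a / (π * (a ^ 2 + x ^ 2))) * g x := by
  rw [cauchyLaw, lintegral_withDensity_eq_lintegral_mul_non_measurable _ (by fun_prop)
    (ae_of_all _ fun _ => ENNReal.ofReal_lt_top)]
  rfl

lemma lintegral_cauchyLaw_comp_arctan {a : ℝ} (ha : 0 < a) (g : ℝ → ENNReal) :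
    ∫⁻ x, g (arctan (x / a)) ∂(cauchyLaw a)
      = ENNReal.ofReal π⁻¹ * ∫⁻ θ in Ioo (-(π / 2)) (π / 2), g θ := by
  have hder : ∀ x ∈ (univ : Set ℝ),
      HasDerivWithinAt (fun x => arctan (x / a)) (a / (a ^ 2 + x ^ 2)) univ x := by
    intro x _
    have h := ((hasDerivAt_id x).div_const a).arctan
    refine (h.congr_deriv ?_).hasDerivWithinAt
    simp only [id]
    field_simp
  have hinj : InjOn (fun x => arctan (x / a)) univ := by
    intro x _ y _ h
    have := arctan_injective h
    field_simp at this
    exact this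
  have himg : (fun x => arctan (x / a)) '' univ = Ioo (-(π / 2)) (π / 2) := by
    rw [← range_arctan, image_univ]
    ext θ
    constructor
    · rintro ⟨x, rfl⟩; exact ⟨x / a, rfl⟩
    · rintro ⟨x, rfl⟩
      refine ⟨x * a, ?_⟩
      simp [ha.ne']
  rw [← himg, lintegral_image_eq_lintegral_abs_deriv_mul MeasurableSet.univ hder hinj,
    lintegral_cauchyLaw, Measure.restrict_univ, ← lintegral_const_mul' _ _ ENNReal.ofReal_ne_top]
  refine lintegral_congr fun x => ?_
  rw [← mul_assoc, ← ENNReal.ofReal_mul (by positivity), abs_of_pos (by positivity)]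
  congr 2
  field_simp

lemma isProbabilityMeasure_cauchyLaw {a : ℝ} (ha : 0 < a) : IsProbabilityMeasure (cauchyLaw a) := by
  refine ⟨?_⟩
  have h := lintegral_cauchyLaw_comp_arctan ha fun _ => 1
  simp only [lintegral_const, one_mul, Measure.restrict_apply_univ, Real.volume_Ioo] at h
  rw [h, ← ENNReal.ofReal_mul (by positivity), ENNReal.ofReal_eq_one]
  field_simp
  ring

lemma integral_log_cos_neg_pi_div_two_pi_div_two :
    ∫ θ in (-(π / 2))..(π / 2), log (cos θ) = -log 2 * π := by
  have h := intervalIntegral.integral_comp_add_right (a := -(π / 2)) (b := π / 2)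
    (fun x => log (sin x)) (π / 2)
  simp only [sin_add_pi_div_two] at h
  rw [h, neg_add_cancel, add_halves, integral_log_sin_zero_pi]

lemma lintegral_log_one_add_sq_cauchyLaw {a : ℝ} (ha : 0 < a) :
    ∫⁻ x, ENNReal.ofReal (log (1 + x ^ 2 / a ^ 2)) ∂(cauchyLaw a) = ENNReal.ofReal (log 4) := by
  have h := lintegral_cauchyLaw_comp_arctan ha fun θ => ENNReal.ofReal (-2 * log (cos θ))
  have hcos : ∀ x : ℝ, -2 * log (cos (arctan (x / a))) = log (1 + x ^ 2 / a ^ 2) := by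
    intro x
    have h2 := congrArg log (cos_sq_arctan (x / a))
    rw [log_pow, one_div, log_inv, div_pow] at h2
    push_cast at h2
    linarith
  simp only [hcos] at h
  rw [h, ← ofReal_integral_eq_lintegral_ofReal]
  · rw [← integral_Ioc_eq_integral_Ioo,
      ← intervalIntegral.integral_of_le (by linarith [pi_pos]), intervalIntegral.integral_const_mul,
      integral_log_cos_neg_pi_div_two_pi_div_two, ← ENNReal.ofReal_mul (by positivity)]
    congr 1
    rw [show (4 : ℝ) = 2 ^ 2 by norm_num, log_pow]
    field_simp
    norm_num
  · have := (intervalIntegrable_log_cos (a := -(π / 2)) (b := π / 2)).const_mul (-2)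
    rw [intervalIntegrable_iff_integrableOn_Ioo_of_le (by linarith [pi_pos])] at this
    exact this
  · filter_upwards [ae_restrict_mem measurableSet_Ioo] with θ hθ
    have := log_nonpos (cos_pos_of_mem_Ioo hθ).le (cos_le_one θ)
    simp only [Pi.zero_apply]
    linarith

lemma tendsto_log_quadratic_ratio (x a b : ℝ) {l : Filter ℝ} (hl : l ≤ Bornology.cobounded ℝ) :
    Tendsto (fun y : ℝ => log ((y ^ 2 + b ^ 2) / ((y - x) ^ 2 + a ^ 2))) l (𝓝 0) := by
  have hinv : Tendsto (fun y : ℝ => y⁻¹) l (𝓝 0) := tendsto_inv₀_cobounded.mono_left hl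
  have hc : ContinuousAt
      (fun u : ℝ => log ((1 + b ^ 2 * u ^ 2) / ((1 - x * u) ^ 2 + a ^ 2 * u ^ 2))) 0 := by
    refine ContinuousAt.log (ContinuousAt.div (by fun_prop) (by fun_prop) (by simp)) (by simp)
  have ht := hc.tendsto.comp hinv
  simp only [mul_zero, sub_zero, one_pow, ne_eq, OfNat.ofNat_ne_zero, not_false_eq_true, zero_pow,
    add_zero, div_one, log_one] at ht
  refine ht.congr' ?_
  have hne : ∀ᶠ y in l, y ≠ (0 : ℝ) := hl (Bornology.eventually_ne_cobounded 0)
  filter_upwards [hne] with y hy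
  simp only [Function.comp]
  congr 1
  rw [← mul_div_mul_left _ _ (pow_ne_zero 2 hy)]
  congr 1 <;> field_simp

lemma integrable_cauchy_mul_cauchy {a b : ℝ} (ha : 0 < a) (hb : 0 < b) (x : ℝ) :
    Integrable fun y : ℝ => 1 / ((y ^ 2 + b ^ 2) * ((y - x) ^ 2 + a ^ 2)) := by
  have h1 : Integrable fun y : ℝ => (1 + (y / b) ^ 2)⁻¹ :=
    integrable_inv_one_add_sq.comp_div hb.ne'
  refine (h1.const_mul (b ^ 2 * a ^ 2)⁻¹).mono' (Measurable.aestronglyMeasurable (by fun_prop))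
    (ae_of_all _ fun y => ?_)
  rw [norm_of_nonneg (by positivity), one_div, ← mul_inv]
  apply inv_anti₀ (by positivity)
  have : b ^ 2 * a ^ 2 * (1 + (y / b) ^ 2) = (y ^ 2 + b ^ 2) * a ^ 2 := by field_simp; ring
  rw [this]
  gcongr
  nlinarith [sq_nonneg (y - x)]

lemma integral_cauchy_mul_cauchy {a b x : ℝ} (ha : 0 < a) (hb : 0 < b) (hx : x ≠ 0) :
    ∫ y : ℝ, 1 / ((y ^ 2 + b ^ 2) * ((y - x) ^ 2 + a ^ 2))
      = π * (a + b) / (a * b * ((a + b) ^ 2 + x ^ 2)) := by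
  set Δ : ℝ := (x ^ 2 + (a + b) ^ 2) * (x ^ 2 + (a - b) ^ 2) with hΔ
  have hx2 : 0 < x ^ 2 := by positivity
  have hΔ0 : 0 < Δ := by positivity
  let F : ℝ → ℝ := fun y =>
    x / Δ * log ((y ^ 2 + b ^ 2) / ((y - x) ^ 2 + a ^ 2))
      + (x ^ 2 + a ^ 2 - b ^ 2) / (Δ * b) * arctan (y / b)
      + (x ^ 2 + b ^ 2 - a ^ 2) / (Δ * a) * arctan ((y - x) / a)
  have hder : ∀ y, HasDerivAt F (1 / ((y ^ 2 + b ^ 2) * ((y - x) ^ 2 + a ^ 2))) y := by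
    intro y
    have hP : 0 < y ^ 2 + b ^ 2 := by positivity
    have hQ : 0 < (y - x) ^ 2 + a ^ 2 := by positivity
    have d1 : HasDerivAt (fun y : ℝ => y ^ 2 + b ^ 2) (2 * y) y := by
      simpa using (hasDerivAt_pow 2 y).add_const (b ^ 2)
    have d2 : HasDerivAt (fun y : ℝ => (y - x) ^ 2 + a ^ 2) (2 * (y - x)) y := by
      simpa using (((hasDerivAt_id y).sub_const x).pow 2).add_const (a ^ 2)
    have d3 := (((d1.div d2 hQ.ne').log (div_pos hP hQ).ne').const_mul (x / Δ))
    have d4 := (((hasDerivAt_id y).div_const b).arctan).const_mul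
      ((x ^ 2 + a ^ 2 - b ^ 2) / (Δ * b))
    have d5 := ((((hasDerivAt_id y).sub_const x).div_const a).arctan).const_mul
      ((x ^ 2 + b ^ 2 - a ^ 2) / (Δ * a))
    refine ((d3.add d4).add d5).congr_deriv ?_
    simp only [id, Pi.div_apply]
    have e1 : (2 * y * ((y - x) ^ 2 + a ^ 2) - (y ^ 2 + b ^ 2) * (2 * (y - x)))
        / ((y - x) ^ 2 + a ^ 2) ^ 2 / ((y ^ 2 + b ^ 2) / ((y - x) ^ 2 + a ^ 2))
        = 2 * y / (y ^ 2 + b ^ 2) - 2 * (y - x) / ((y - x) ^ 2 + a ^ 2) := by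
      field_simp
    have e2 : 1 / (1 + (y / b) ^ 2) * (1 / b) = b / (y ^ 2 + b ^ 2) := by
      field_simp; ring
    have e3 : 1 / (1 + ((y - x) / a) ^ 2) * (1 / a) = a / ((y - x) ^ 2 + a ^ 2) := by
      field_simp; ring
    rw [e1, e2, e3]
    field_simp
    rw [hΔ]
    ring
  have hcoef : (x ^ 2 + a ^ 2 - b ^ 2) / (Δ * b) + (x ^ 2 + b ^ 2 - a ^ 2) / (Δ * a)
      = (a + b) / (a * b * ((a + b) ^ 2 + x ^ 2)) := by
    rw [hΔ] at hΔ0 ⊢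
    have : x ^ 2 + (a - b) ^ 2 ≠ 0 := by positivity
    field_simp
    ring
  have htop : Tendsto F atTop (𝓝 (x / Δ * 0
      + (x ^ 2 + a ^ 2 - b ^ 2) / (Δ * b) * (π / 2)
      + (x ^ 2 + b ^ 2 - a ^ 2) / (Δ * a) * (π / 2))) := by
    have t1 : Tendsto (fun y : ℝ => arctan (y / b)) atTop (𝓝 (π / 2)) :=
      (tendsto_nhds_of_tendsto_nhdsWithin tendsto_arctan_atTop).comp
        (tendsto_id.atTop_div_const hb)
    have t2 : Tendsto (fun y : ℝ => arctan ((y - x) / a)) atTop (𝓝 (π / 2)) :=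
      (tendsto_nhds_of_tendsto_nhdsWithin tendsto_arctan_atTop).comp
        ((tendsto_atTop_add_const_right _ (-x) tendsto_id).atTop_div_const ha)
    exact (((tendsto_log_quadratic_ratio x a b (by
      rw [IsOrderBornology.cobounded_eq]; exact le_sup_right)).const_mul _).add
      (t1.const_mul _)).add (t2.const_mul _)
  have hbot : Tendsto F atBot (𝓝 (x / Δ * 0
      + (x ^ 2 + a ^ 2 - b ^ 2) / (Δ * b) * (-(π / 2))
      + (x ^ 2 + b ^ 2 - a ^ 2) / (Δ * a) * (-(π / 2)))) := by
    have t1 : Tendsto (fun y : ℝ => arctan (y / b)) atBot (𝓝 (-(π / 2))) :=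
      (tendsto_nhds_of_tendsto_nhdsWithin tendsto_arctan_atBot).comp
        (tendsto_id.atBot_div_const hb)
    have t2 : Tendsto (fun y : ℝ => arctan ((y - x) / a)) atBot (𝓝 (-(π / 2))) :=
      (tendsto_nhds_of_tendsto_nhdsWithin tendsto_arctan_atBot).comp
        ((tendsto_atBot_add_const_right _ (-x) tendsto_id).atBot_div_const ha)
    exact (((tendsto_log_quadratic_ratio x a b (by
      rw [IsOrderBornology.cobounded_eq]; exact le_sup_left)).const_mul _).add
      (t1.const_mul _)).add (t2.const_mul _)
  rw [integral_of_hasDerivAt_of_tendsto hder (integrable_cauchy_mul_cauchy ha hb x) hbot htop,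
    mul_div_assoc, ← hcoef]
  ring

lemma lintegral_cauchy_sub_cauchyLaw {a b x : ℝ} (ha : 0 < a) (hb : 0 < b) (hx : x ≠ 0) :
    ∫⁻ y, ENNReal.ofReal (a / (π * (a ^ 2 + (x - y) ^ 2))) ∂(cauchyLaw b)
      = ENNReal.ofReal ((a + b) / (π * ((a + b) ^ 2 + x ^ 2))) := by
  have hfun : ∀ y : ℝ, ENNReal.ofReal (b / (π * (b ^ 2 + y ^ 2)))
      * ENNReal.ofReal (a / (π * (a ^ 2 + (x - y) ^ 2)))
      = ENNReal.ofReal (a * b / π ^ 2 * (1 / ((y ^ 2 + b ^ 2) * ((y - x) ^ 2 + a ^ 2)))) := by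
    intro y
    rw [← ENNReal.ofReal_mul (by positivity)]
    congr 1
    rw [show (x - y) ^ 2 = (y - x) ^ 2 by ring]
    field_simp
    ring
  rw [lintegral_cauchyLaw]
  simp only [hfun]
  rw [← ofReal_integral_eq_lintegral_ofReal
    ((integrable_cauchy_mul_cauchy ha hb x).const_mul _) (ae_of_all _ fun y => by positivity),
    integral_const_mul, integral_cauchy_mul_cauchy ha hb hx]
  congr 1
  field_simp

/-- The logarithm of the ratio between the Cauchy density with scale `D` at `x - y` and the Cauchy
density with scale `γ` at `x`, as a function of `(x, y)`. -/
noncomputable def cauchyLogRatio (γ D : ℝ) (p : ℝ × ℝ) : ℝ :=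
  log (γ / D) - log (1 + (p.1 - p.2) ^ 2 / D ^ 2) + log (1 + p.1 ^ 2 / γ ^ 2)

lemma measurable_cauchyLogRatio (γ D : ℝ) : Measurable (cauchyLogRatio γ D) := by
  unfold cauchyLogRatio
  fun_prop

lemma exp_cauchyLogRatio {γ D : ℝ} (hγ : 0 < γ) (hD : 0 < D) (p : ℝ × ℝ) :
    exp (cauchyLogRatio γ D p)
      = D / (π * (D ^ 2 + (p.1 - p.2) ^ 2)) / (γ / (π * (γ ^ 2 + p.1 ^ 2))) := by
  rw [cauchyLogRatio, exp_add, exp_sub, exp_log (by positivity), exp_log (by positivity),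
    exp_log (by positivity)]
  field_simp

lemma integrable_and_integral_eq_of_lintegral_ofReal_ne_top {α : Type*} [MeasurableSpace α]
    {μ : Measure α} {f : α → ℝ} (hf : Measurable f) (h0 : ∀ x, 0 ≤ f x)
    (h : ∫⁻ x, ENNReal.ofReal (f x) ∂μ ≠ ⊤) :
    Integrable f μ ∧ ∫ x, f x ∂μ = (∫⁻ x, ENNReal.ofReal (f x) ∂μ).toReal :=
  ⟨(lintegral_ofReal_ne_top_iff_integrable hf.aestronglyMeasurable (ae_of_all _ h0)).1 h,
    integral_eq_lintegral_of_nonneg_ae (ae_of_all _ h0) hf.aestronglyMeasurable⟩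

lemma integral_cauchyLogRatio {γ D : ℝ} (hγ : 0 < γ) {μ : Measure (ℝ × ℝ)}
    [IsProbabilityMeasure μ] (hfst : μ.fst = cauchyLaw γ)
    (hfin : ∫⁻ p : ℝ × ℝ, ENNReal.ofReal (log (1 + (p.1 - p.2) ^ 2 / D ^ 2)) ∂μ ≠ ⊤) :
    Integrable (cauchyLogRatio γ D) μ ∧ ∫ p, cauchyLogRatio γ D p ∂μ
      = log (γ / D)
        - (∫⁻ p : ℝ × ℝ, ENNReal.ofReal (log (1 + (p.1 - p.2) ^ 2 / D ^ 2)) ∂μ).toReal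
        + log 4 := by
  have hx : ∫⁻ p : ℝ × ℝ, ENNReal.ofReal (log (1 + p.1 ^ 2 / γ ^ 2)) ∂μ
      = ENNReal.ofReal (log 4) := by
    rw [← lintegral_log_one_add_sq_cauchyLaw hγ, ← hfst, Measure.fst,
      lintegral_map (by fun_prop) measurable_fst]
  obtain ⟨i1, e1⟩ := integrable_and_integral_eq_of_lintegral_ofReal_ne_top
    (f := fun p : ℝ × ℝ => log (1 + (p.1 - p.2) ^ 2 / D ^ 2)) (by fun_prop)
    (fun p => log_nonneg (le_add_of_nonneg_right (by positivity))) hfin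
  obtain ⟨i2, e2⟩ := integrable_and_integral_eq_of_lintegral_ofReal_ne_top (μ := μ)
    (f := fun p : ℝ × ℝ => log (1 + p.1 ^ 2 / γ ^ 2)) (by fun_prop)
    (fun p => log_nonneg (le_add_of_nonneg_right (by positivity)))
    (by rw [hx]; exact ENNReal.ofReal_ne_top)
  have i3 : Integrable (fun p : ℝ × ℝ => log (γ / D) - log (1 + (p.1 - p.2) ^ 2 / D ^ 2)) μ :=
    (integrable_const _).sub i1
  refine ⟨i3.add i2, ?_⟩
  unfold cauchyLogRatio
  rw [integral_add i3 i2, integral_sub (integrable_const _) i1, e1, e2,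
    hx, ENNReal.toReal_ofReal (log_nonneg (by norm_num))]
  simp

lemma lintegral_exp_cauchyLogRatio_mul_left {γ D : ℝ} (hγ : 0 < γ) (hD : 0 < D) (y : ℝ)
    (h : ℝ → ENNReal) :
    ∫⁻ x, ENNReal.ofReal (exp (cauchyLogRatio γ D (x, y))) * h (x - y) ∂(cauchyLaw γ)
      = ∫⁻ x, h x ∂(cauchyLaw D) := by
  rw [lintegral_cauchyLaw, lintegral_cauchyLaw,
    ← lintegral_sub_right_eq_self (fun x => ENNReal.ofReal (D / (π * (D ^ 2 + x ^ 2))) * h x) y]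
  refine lintegral_congr fun x => ?_
  rw [← mul_assoc, ← ENNReal.ofReal_mul (by positivity), exp_cauchyLogRatio hγ hD,
    mul_div_cancel₀ _ (by positivity)]

lemma lintegral_exp_cauchyLogRatio_right {γ D : ℝ} (hD : 0 < D) (hDγ : D < γ) {x : ℝ}
    (hx : x ≠ 0) :
    ∫⁻ y, ENNReal.ofReal (exp (cauchyLogRatio γ D (x, y))) ∂(cauchyLaw (γ - D)) = 1 := by
  have hγ : 0 < γ := hD.trans hDγ
  have hpos : 0 < γ / (π * (γ ^ 2 + x ^ 2)) := by positivity
  have h : ∀ y, ENNReal.ofReal (exp (cauchyLogRatio γ D (x, y)))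
      = ENNReal.ofReal (D / (π * (D ^ 2 + (x - y) ^ 2)))
        * ENNReal.ofReal (γ / (π * (γ ^ 2 + x ^ 2)))⁻¹ := by
    intro y
    rw [exp_cauchyLogRatio hγ hD, ← ENNReal.ofReal_mul (by positivity), div_eq_mul_inv]
  simp only [h]
  rw [lintegral_mul_const' _ _ ENNReal.ofReal_ne_top,
    lintegral_cauchy_sub_cauchyLaw hD (sub_pos.2 hDγ) hx, add_sub_cancel,
    ← ENNReal.ofReal_mul hpos.le, mul_inv_cancel₀ hpos.ne', ENNReal.ofReal_one]

lemma lintegral_prod_exp_cauchyLogRatio_mul {γ D : ℝ} (hγ : 0 < γ) (hD : 0 < D) (ρ : Measure ℝ)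
    [IsProbabilityMeasure ρ] {f h : ℝ → ENNReal} (hf : Measurable f) (hh : Measurable h) :
    ∫⁻ p : ℝ × ℝ, ENNReal.ofReal (exp (cauchyLogRatio γ D p)) * (h (p.1 - p.2) * f p.2)
        ∂((cauchyLaw γ).prod ρ)
      = (∫⁻ x, h x ∂(cauchyLaw D)) * ∫⁻ y, f y ∂ρ := by
  have := isProbabilityMeasure_cauchyLaw hγ
  have hm := measurable_cauchyLogRatio γ D
  rw [lintegral_prod_symm' _ (by fun_prop), ← lintegral_const_mul _ hf]
  refine lintegral_congr fun y => ?_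
  simp only [← mul_assoc]
  rw [lintegral_mul_const _ (by fun_prop), lintegral_exp_cauchyLogRatio_mul_left hγ hD]

lemma integral_exp_cauchyLogRatio {γ D : ℝ} (hγ : 0 < γ) (hD : 0 < D) (ρ : Measure ℝ)
    [IsProbabilityMeasure ρ] :
    Integrable (fun p => exp (cauchyLogRatio γ D p)) ((cauchyLaw γ).prod ρ) ∧
      ∫ p, exp (cauchyLogRatio γ D p) ∂((cauchyLaw γ).prod ρ) = 1 := by
  have := isProbabilityMeasure_cauchyLaw hD
  have h := lintegral_prod_exp_cauchyLogRatio_mul hγ hD ρ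
    (measurable_const (a := (1 : ENNReal))) (measurable_const (a := (1 : ENNReal)))
  simp only [mul_one, lintegral_one, measure_univ] at h
  obtain ⟨i, e⟩ := integrable_and_integral_eq_of_lintegral_ofReal_ne_top
    (measurable_cauchyLogRatio γ D).exp (fun p => (exp_pos _).le) (h ▸ ENNReal.one_ne_top)
  exact ⟨i, by rw [e, h, ENNReal.toReal_one]⟩

lemma le_mutualInfo {γ D : ℝ} (hγ : 0 < γ) (hD : 0 < D) {μ : Measure (ℝ × ℝ)}
    [IsProbabilityMeasure μ] (hfst : μ.fst = cauchyLaw γ)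
    (hdist : ∫⁻ p : ℝ × ℝ, ENNReal.ofReal (log (1 + (p.1 - p.2) ^ 2 / D ^ 2)) ∂μ
      ≤ ENNReal.ofReal (log 4)) :
    ((max (log (γ / D)) 0 : ℝ) : EReal) ≤ mutualInfo μ := by
  unfold mutualInfo
  split_ifs with hμ
  swap
  · exact le_top
  obtain ⟨hac, hint⟩ := hμ
  rw [EReal.coe_le_coe_iff]
  apply max_le
  · have hlog4 : 0 ≤ log (4 : ℝ) := log_nonneg (by norm_num)
    obtain ⟨i, e⟩ := integral_cauchyLogRatio hγ hfst (ne_top_of_le_ne_top ENNReal.ofReal_ne_top hdist)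
    obtain ⟨iexp, eexp⟩ := integral_exp_cauchyLogRatio hγ hD μ.snd
    rw [← hfst] at iexp eexp
    have := isProbabilityMeasure_tilted iexp
    have h1 := integral_llr_tilted_right hac i iexp hint
    have h2 := InformationTheory.integral_llr_add_sub_measure_univ_nonneg
      (hac.trans (absolutelyContinuous_tilted iexp))
      (integrable_llr_tilted_right hac i hint iexp)
    rw [h1, eexp, e] at h2
    simp only [log_one, add_zero, probReal_univ, add_sub_cancel_right] at h2
    have h3 := ENNReal.toReal_mono ENNReal.ofReal_ne_top hdist
    rw [ENNReal.toReal_ofReal hlog4] at h3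
    linarith
  · have h := InformationTheory.integral_llr_add_sub_measure_univ_nonneg hac hint
    simpa using h

lemma exists_mutualInfo_eq_zero {γ D : ℝ} (hγ : 0 < γ) (hγD : γ ≤ D) :
    ∃ μ : Measure (ℝ × ℝ), IsProbabilityMeasure μ ∧ μ.fst = cauchyLaw γ ∧
      (∫⁻ p : ℝ × ℝ, ENNReal.ofReal (log (1 + (p.1 - p.2) ^ 2 / D ^ 2)) ∂μ)
          ≤ ENNReal.ofReal (log 4) ∧ mutualInfo μ = 0 := by
  have := isProbabilityMeasure_cauchyLaw hγ
  refine ⟨(cauchyLaw γ).prod (Measure.dirac 0), inferInstance, Measure.fst_prod, ?_, ?_⟩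
  · rw [lintegral_prod _ (by fun_prop), ← lintegral_log_one_add_sq_cauchyLaw hγ]
    refine lintegral_mono fun x => ?_
    simp only [lintegral_dirac, sub_zero]
    gcongr
  · unfold mutualInfo
    rw [Measure.fst_prod, Measure.snd_prod, if_pos ⟨Measure.AbsolutelyContinuous.rfl,
      (integrable_congr (llr_self _)).2 (integrable_zero _ _ _)⟩, integral_congr_ae (llr_self _)]
    simp

lemma exists_mutualInfo_eq_log {γ D : ℝ} (hD : 0 < D) (hDγ : D < γ) :
    ∃ μ : Measure (ℝ × ℝ), IsProbabilityMeasure μ ∧ μ.fst = cauchyLaw γ ∧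
      (∫⁻ p : ℝ × ℝ, ENNReal.ofReal (log (1 + (p.1 - p.2) ^ 2 / D ^ 2)) ∂μ)
          ≤ ENNReal.ofReal (log 4) ∧ mutualInfo μ = ((log (γ / D) : ℝ) : EReal) := by
  have hγ : 0 < γ := hD.trans hDγ
  have := isProbabilityMeasure_cauchyLaw hγ
  have := isProbabilityMeasure_cauchyLaw hD
  have := isProbabilityMeasure_cauchyLaw (sub_pos.2 hDγ)
  have hm := measurable_cauchyLogRatio γ D
  set ν := (cauchyLaw γ).prod (cauchyLaw (γ - D)) with hν
  obtain ⟨iexp, eexp⟩ := integral_exp_cauchyLogRatio hγ hD (cauchyLaw (γ - D))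
  rw [← hν] at iexp eexp
  set μ := ν.tilted (cauchyLogRatio γ D) with hμ
  have hprob : IsProbabilityMeasure μ := isProbabilityMeasure_tilted iexp
  have hlin : ∀ g : ℝ × ℝ → ENNReal, Measurable g →
      ∫⁻ p, g p ∂μ = ∫⁻ p, ENNReal.ofReal (exp (cauchyLogRatio γ D p)) * g p ∂ν := by
    intro g hg
    rw [hμ, Measure.tilted, eexp]
    simp only [div_one]
    rw [lintegral_withDensity_eq_lintegral_mul _ (by fun_prop) hg]
    rfl
  have hfst : μ.fst = cauchyLaw γ := by
    refine Measure.ext_of_lintegral _ fun f hf => ?_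
    rw [Measure.fst, lintegral_map hf measurable_fst, hlin _ (by fun_prop), hν,
      lintegral_prod _ (by fun_prop)]
    have hne : ∀ᵐ x ∂(cauchyLaw γ), x ≠ 0 :=
      (withDensity_absolutelyContinuous _ _).ae_le (compl_mem_ae_iff.2 (measure_singleton 0))
    refine lintegral_congr_ae ?_
    filter_upwards [hne] with x hx
    rw [lintegral_mul_const _ (by fun_prop), lintegral_exp_cauchyLogRatio_right hD hDγ hx, one_mul]
  have hsnd : μ.snd = cauchyLaw (γ - D) := by
    refine Measure.ext_of_lintegral _ fun f hf => ?_
    rw [Measure.snd, lintegral_map hf measurable_snd, hlin _ (by fun_prop), hν]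
    have h := lintegral_prod_exp_cauchyLogRatio_mul hγ hD (cauchyLaw (γ - D)) hf
      (measurable_const (a := (1 : ENNReal)))
    simpa using h
  have hdist : ∫⁻ p : ℝ × ℝ, ENNReal.ofReal (log (1 + (p.1 - p.2) ^ 2 / D ^ 2)) ∂μ
      = ENNReal.ofReal (log 4) := by
    rw [hlin _ (by fun_prop), hν, ← lintegral_log_one_add_sq_cauchyLaw hD]
    have h := lintegral_prod_exp_cauchyLogRatio_mul hγ hD (cauchyLaw (γ - D))
      (measurable_const (a := (1 : ENNReal)))
      (h := fun x => ENNReal.ofReal (log (1 + x ^ 2 / D ^ 2))) (by fun_prop)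
    simpa using h
  refine ⟨μ, hprob, hfst, hdist.le, ?_⟩
  obtain ⟨i, e⟩ := integral_cauchyLogRatio hγ hfst (hdist ▸ ENNReal.ofReal_ne_top)
  have hac : μ ≪ ν := tilted_absolutelyContinuous _ _
  have hllr : llr μ ν =ᵐ[μ] cauchyLogRatio γ D := by
    refine hac.ae_le ?_
    filter_upwards [llr_tilted_left Measure.AbsolutelyContinuous.rfl iexp hm.aemeasurable,
      llr_self ν] with p h1 h2
    rw [hμ, h1, h2, eexp]
    simp
  unfold mutualInfo
  rw [hfst, hsnd, ← hν, if_pos ⟨hac, (integrable_congr hllr).2 i⟩, integral_congr_ae hllr, e, hdist,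
    ENNReal.toReal_ofReal (log_nonneg (by norm_num)), sub_add_cancel]

/-- The single-letter information rate-distortion function of a Cauchy source with
scale `γ` under the CB-strength distortion constraint `s₁(X - X̂) ≤ D` is
`max {ln(γ/D), 0}`. -/
theorem cauchy_rate_distortion (γ : ℝ) (hγ : 0 < γ) (D : ℝ) (hD : 0 < D) :
    sInf {I : EReal | ∃ μ : Measure (ℝ × ℝ), IsProbabilityMeasure μ ∧
        μ.fst = cauchyLaw γ ∧
        (∫⁻ p : ℝ × ℝ, ENNReal.ofReal (Real.log (1 + (p.1 - p.2) ^ 2 / D ^ 2)) ∂μ)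
          ≤ ENNReal.ofReal (Real.log 4) ∧
        I = mutualInfo μ} = ((max (Real.log (γ / D)) 0 : ℝ) : EReal) := by
  refine le_antisymm ?_ (le_sInf ?_)
  · rcases le_or_gt γ D with h | h
    · obtain ⟨μ, h1, h2, h3, h4⟩ := exists_mutualInfo_eq_zero hγ h
      have h0 : log (γ / D) ≤ 0 := log_nonpos (by positivity) ((div_le_one hD).2 h)
      exact sInf_le ⟨μ, h1, h2, h3, by rw [h4, max_eq_right h0, EReal.coe_zero]⟩
    · obtain ⟨μ, h1, h2, h3, h4⟩ := exists_mutualInfo_eq_log hD h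
      have h0 : 0 ≤ log (γ / D) := log_nonneg ((one_le_div hD).2 h.le)
      exact sInf_le ⟨μ, h1, h2, h3, by rw [h4, max_eq_left h0]⟩
  · rintro I ⟨μ, h1, h2, h3, rfl⟩
    exact le_mutualInfo hγ hD h2 h3
end

section
/- Let X be a real random variable possessing a probability density and satisfying E[ln(1 + |X|)] < ∞. For Δ > 0 let X̂_Δ = Δ·k when X ∈ (kΔ − Δ/2, kΔ + Δ/2] (k ∈ ℤ), and let q_Δ = X − X̂_Δ be the quantization error, which satisfies P(q_Δ ≠ 0) > 0. Let s(Δ) := s₁(q_Δ) be the CB-strength of the error. Then s(Δ)/Δ → s₁(U) as Δ → 0⁺, where U is uniform on (−1/2, 1/2) and s₁(U) is the unique s > 0 with ∫_{−1/2}^{1/2} ln(1 + u²/s²) du = ln 4. -/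
open MeasureTheory Filter

/-- The CB-strength (the strength for `α = 1`) of a real random variable `Y` on a
probability space `(Ω, P)`: `inf {s > 0 : E[ln(1 + Y²/s²)] ≤ ln 4}`. It is `0`
when `Y = 0` a.s., and otherwise the unique `s > 0` with `E[ln(1 + Y²/s²)] = ln 4`. -/
noncomputable def s1 {Ω : Type*} [MeasurableSpace Ω] (P : Measure Ω) (Y : Ω → ℝ) : ℝ :=
  sInf {s : ℝ | 0 < s ∧ (∫ ω, Real.log (1 + (Y ω) ^ 2 / s ^ 2) ∂P) ≤ Real.log 4}

open Topology Pointwise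

/-- The centered residue modulo `1` has the absolute value of the norm on the unit circle. -/
lemma sq_sub_ceil_sub_half (y : ℝ) :
    (y - (⌈y - 1 / 2⌉ : ℤ)) ^ 2 = ‖(y : UnitAddCircle)‖ ^ 2 := by
  have hle : |y - (⌈y - 1 / 2⌉ : ℤ)| ≤ |(1 : ℝ)| / 2 := by
    rw [abs_one, abs_le]
    have h₁ := Int.le_ceil (y - 1 / 2)
    have h₂ := Int.ceil_lt_add_one (y - 1 / 2)
    constructor <;> linarith
  have h := (AddCircle.norm_coe_eq_abs_iff (1 : ℝ) one_ne_zero).2 hle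
  have hcoe : ((y - (⌈y - 1 / 2⌉ : ℤ) : ℝ) : UnitAddCircle) = (y : UnitAddCircle) := by
    rw [AddCircle.coe_sub, sub_eq_self, AddCircle.coe_eq_zero_iff]
    exact ⟨⌈y - 1 / 2⌉, by simp⟩
  rw [hcoe] at h
  rw [h, sq_abs]

section Equidistribution

variable {Ω : Type*} [MeasurableSpace Ω] {P : Measure Ω} [IsProbabilityMeasure P] {X : Ω → ℝ}

lemma integrable_comp_coe_div (hX : Measurable X) (f : C(UnitAddCircle, ℂ)) (Δ : ℝ) :
    Integrable (fun ω => f ((X ω / Δ : ℝ) : UnitAddCircle)) P := by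
  refine Integrable.of_bound (C := ‖f‖) ?_ (ae_of_all _ fun ω => f.norm_coe_le_norm _)
  exact ((f.continuous.comp (AddCircle.continuous_mk' (1 : ℝ))).measurable.comp
    (hX.div_const Δ)).aestronglyMeasurable

lemma tendsto_integral_fourier_div (hpdf : HasPDF X P volume) (n : ℤ) :
    Tendsto (fun Δ : ℝ => ∫ ω, fourier n ((X ω / Δ : ℝ) : UnitAddCircle) ∂P) (𝓝[>] 0)
      (𝓝 (∫ b : UnitAddCircle, fourier n b)) := by
  have hlim : ∫ b : UnitAddCircle, (fourier n b : ℂ) = if n = 0 then 1 else 0 := by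
    have h := congrFun (fourierCoeff_fourier (T := (1 : ℝ)) n) 0
    rw [fourierCoeff, AddCircle.integral_haarAddCircle] at h
    simpa [Pi.single_apply, eq_comm] using h
  rw [hlim]
  split_ifs with hn
  · subst hn
    simp
  have hcob : Tendsto (fun Δ : ℝ => (-n : ℝ) * Δ⁻¹) (𝓝[>] 0) (cocompact ℝ) := by
    rw [← Metric.cobounded_eq_cocompact]
    refine (tendsto_mul_left_cobounded (by simpa using hn)).comp ?_
    exact tendsto_inv₀_nhdsNE_zero.mono_left (nhdsWithin_mono _ fun x hx => ne_of_gt hx)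
  have hRL := (Real.tendsto_integral_exp_smul_cocompact
    (fun v => ((pdf X P volume v).toReal : ℂ))).comp hcob
  refine hRL.congr fun Δ => ?_
  have hmeas : AEStronglyMeasurable
      (fun x : ℝ => (fourier n ((x / Δ : ℝ) : UnitAddCircle) : ℂ)) volume := by
    refine Continuous.aestronglyMeasurable ?_
    exact (fourier n).continuous.comp ((AddCircle.continuous_mk' (1 : ℝ)).comp
      (continuous_id.div_const Δ))
  rw [← pdf.integral_pdf_smul (X := X) (ℙ := P) hmeas, Function.comp_apply]
  refine integral_congr_ae (ae_of_all _ fun v => ?_)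
  simp only [fourier_coe_apply, Circle.smul_def, Real.fourierChar_apply, smul_eq_mul,
    Complex.real_smul]
  rw [mul_comm]
  congr 2
  push_cast
  ring

/-- If `X` has a density, then `X / Δ` equidistributes modulo `1` as `Δ → 0⁺`. -/
lemma tendsto_integral_comp_coe_div (hX : Measurable X) (hpdf : HasPDF X P volume)
    (f : C(UnitAddCircle, ℂ)) :
    Tendsto (fun Δ : ℝ => ∫ ω, f ((X ω / Δ : ℝ) : UnitAddCircle) ∂P) (𝓝[>] 0)
      (𝓝 (∫ b : UnitAddCircle, f b)) := by
  have hint : ∀ g : C(UnitAddCircle, ℂ), Integrable (fun b => g b) volume := fun g =>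
    g.continuous.integrable_of_hasCompactSupport (HasCompactSupport.of_compactSpace _)
  have hspan : ∀ g ∈ Submodule.span ℂ (Set.range (@fourier (1 : ℝ))),
      Tendsto (fun Δ : ℝ => ∫ ω, g ((X ω / Δ : ℝ) : UnitAddCircle) ∂P) (𝓝[>] 0)
        (𝓝 (∫ b : UnitAddCircle, g b)) := by
    intro g hg
    induction hg using Submodule.span_induction with
    | mem g hg =>
      obtain ⟨n, rfl⟩ := hg
      exact tendsto_integral_fourier_div hpdf n
    | zero => simp
    | add g h _ _ hg hh =>
      simp only [ContinuousMap.add_apply]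
      rw [integral_add (hint g) (hint h)]
      refine (hg.add hh).congr fun Δ => ?_
      rw [integral_add (integrable_comp_coe_div hX g Δ) (integrable_comp_coe_div hX h Δ)]
    | smul a g _ hg =>
      simp only [ContinuousMap.smul_apply, integral_smul]
      exact hg.const_smul a
  have hmem : f ∈ closure (Submodule.span ℂ (Set.range (@fourier (1 : ℝ))) :
      Set C(UnitAddCircle, ℂ)) := by
    rw [← Submodule.topologicalClosure_coe, span_fourier_closure_eq_top]
    trivial
  rw [Metric.tendsto_nhds]
  intro ε hε
  obtain ⟨g, hg, hfg⟩ := Metric.mem_closure_iff.1 hmem (ε / 3) (by positivity)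
  rw [dist_eq_norm] at hfg
  have hbd : ∀ b, ‖f b - g b‖ ≤ ε / 3 := fun b => ((f - g).norm_coe_le_norm b).trans hfg.le
  filter_upwards [Metric.tendsto_nhds.1 (hspan g hg) (ε / 3) (by positivity)] with Δ hΔ
  have h₁ : dist (∫ ω, f ((X ω / Δ : ℝ) : UnitAddCircle) ∂P)
      (∫ ω, g ((X ω / Δ : ℝ) : UnitAddCircle) ∂P) ≤ ε / 3 := by
    rw [dist_eq_norm, ← integral_sub (integrable_comp_coe_div hX f Δ)
      (integrable_comp_coe_div hX g Δ)]
    refine (norm_integral_le_of_norm_le_const (ae_of_all _ fun ω => hbd _)).trans ?_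
    simp
  have h₂ : dist (∫ b : UnitAddCircle, g b) (∫ b : UnitAddCircle, f b) ≤ ε / 3 := by
    rw [dist_comm, dist_eq_norm, ← integral_sub (hint f) (hint g)]
    refine (norm_integral_le_of_norm_le_const (ae_of_all _ fun b => hbd b)).trans ?_
    rw [measureReal_def, UnitAddCircle.measure_univ, ENNReal.toReal_one, mul_one]
  linarith [dist_triangle4 (∫ ω, f ((X ω / Δ : ℝ) : UnitAddCircle) ∂P)
    (∫ ω, g ((X ω / Δ : ℝ) : UnitAddCircle) ∂P) (∫ b : UnitAddCircle, g b)
    (∫ b : UnitAddCircle, f b)]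

lemma tendsto_integral_log_residue (hX : Measurable X) (hpdf : HasPDF X P volume) (t : ℝ) :
    Tendsto (fun Δ : ℝ => ∫ ω, Real.log
        (1 + (X ω / Δ - (⌈X ω / Δ - 1 / 2⌉ : ℤ)) ^ 2 / t ^ 2) ∂P) (𝓝[>] 0)
      (𝓝 (∫ u in (-(1 : ℝ) / 2)..(1 / 2), Real.log (1 + u ^ 2 / t ^ 2))) := by
  have hcont : Continuous fun b : UnitAddCircle => Real.log (1 + ‖b‖ ^ 2 / t ^ 2) :=
    Continuous.log (by fun_prop) fun b => by positivity
  let f : C(UnitAddCircle, ℂ) :=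
    ⟨fun b => (Real.log (1 + ‖b‖ ^ 2 / t ^ 2) : ℂ), Complex.continuous_ofReal.comp hcont⟩
  have h := (Complex.continuous_re.tendsto _).comp (tendsto_integral_comp_coe_div hX hpdf f)
  simp only [f, ContinuousMap.coe_mk, integral_complex_ofReal, Complex.ofReal_re,
    Function.comp_def] at h
  simp only [sq_sub_ceil_sub_half]
  convert h using 2
  rw [← UnitAddCircle.intervalIntegral_preimage (-(1 : ℝ) / 2),
    show (-(1 : ℝ) / 2 + 1) = 1 / 2 by norm_num]
  refine intervalIntegral.integral_congr fun u hu => ?_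
  rw [Set.uIcc_of_le (by norm_num)] at hu
  have hu' : |u| ≤ |(1 : ℝ)| / 2 := by
    rw [abs_one, abs_le]
    constructor <;> linarith [hu.1, hu.2]
  simp only [(AddCircle.norm_coe_eq_abs_iff (1 : ℝ) one_ne_zero).2 hu', sq_abs]

lemma integrable_log_residue (hX : Measurable X) (Δ t : ℝ) :
    Integrable (fun ω => Real.log
      (1 + (X ω / Δ - (⌈X ω / Δ - 1 / 2⌉ : ℤ)) ^ 2 / t ^ 2)) P := by
  have hcont : Continuous fun b : UnitAddCircle => Real.log (1 + ‖b‖ ^ 2 / t ^ 2) :=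
    Continuous.log (by fun_prop) fun b => by positivity
  have h := (integrable_comp_coe_div (P := P) hX
    ⟨fun b => (Real.log (1 + ‖b‖ ^ 2 / t ^ 2) : ℂ), Complex.continuous_ofReal.comp hcont⟩ Δ).re
  simp only [sq_sub_ceil_sub_half]
  simpa using h

end Equidistribution

section UniformStrength

lemma continuous_log_one_add_sq_mul_sq :
    Continuous fun p : ℝ × ℝ => Real.log (1 + p.2 ^ 2 * p.1 ^ 2) :=
  Continuous.log (by fun_prop) fun p => by positivity

lemma integral_log_one_add_sq_mul_sq_strictMonoOn :
    StrictMonoOn (fun b : ℝ => ∫ u in (-(1 : ℝ) / 2)..(1 / 2), Real.log (1 + u ^ 2 * b ^ 2))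
      (Set.Ici 0) := by
  intro a ha b _ hab
  have ha : 0 ≤ a := ha
  have hcont : ∀ c : ℝ, Continuous fun u : ℝ => Real.log (1 + u ^ 2 * c ^ 2) := fun c =>
    continuous_log_one_add_sq_mul_sq.comp (Continuous.prodMk_right c)
  refine intervalIntegral.integral_lt_integral_of_continuousOn_of_le_of_exists_lt (by norm_num)
    (hcont a).continuousOn (hcont b).continuousOn (fun u _ => ?_)
    ⟨1 / 2, by norm_num, Real.log_lt_log (by positivity) (by gcongr)⟩
  exact Real.log_le_log (by positivity) (by gcongr)

lemma integral_log_one_add_sq_div_sq_strictAntiOn :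
    StrictAntiOn (fun s : ℝ => ∫ u in (-(1 : ℝ) / 2)..(1 / 2), Real.log (1 + u ^ 2 / s ^ 2))
      (Set.Ioi 0) := by
  intro a ha b hb hab
  have ha : 0 < a := ha
  have hb : 0 < b := hb
  have h := integral_log_one_add_sq_mul_sq_strictMonoOn (inv_nonneg.2 hb.le)
    (inv_nonneg.2 ha.le) (inv_strictAnti₀ ha hab)
  simpa only [inv_pow, ← div_eq_mul_inv] using h

lemma exists_integral_log_one_add_sq_div_sq_eq_log_four :
    ∃ s : ℝ, 0 < s ∧
      (∫ u in (-(1 : ℝ) / 2)..(1 / 2), Real.log (1 + u ^ 2 / s ^ 2)) = Real.log 4 := by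
  have hcont : ∀ c : ℝ, Continuous fun u : ℝ => Real.log (1 + u ^ 2 * c ^ 2) := fun c =>
    continuous_log_one_add_sq_mul_sq.comp (Continuous.prodMk_right c)
  have hparam : Continuous fun b : ℝ =>
      ∫ u in (-(1 : ℝ) / 2)..(1 / 2), Real.log (1 + u ^ 2 * b ^ 2) :=
    intervalIntegral.continuous_parametric_intervalIntegral_of_continuous'
      (f := fun b u : ℝ => Real.log (1 + u ^ 2 * b ^ 2)) continuous_log_one_add_sq_mul_sq _ _
  have hlow : (∫ u in (-(1 : ℝ) / 2)..(1 / 2), Real.log (1 + u ^ 2 * 1 ^ 2)) ≤ Real.log 4 := by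
    calc _ ≤ ∫ _ in (-(1 : ℝ) / 2)..(1 / 2), Real.log 4 := by
          refine intervalIntegral.integral_mono_on (by norm_num)
            ((hcont 1).intervalIntegrable _ _) intervalIntegrable_const fun u hu => ?_
          exact Real.log_le_log (by positivity) (by nlinarith [hu.1, hu.2])
      _ = _ := by
          rw [intervalIntegral.integral_const, smul_eq_mul]
          norm_num
  have hhigh : Real.log 4 ≤
      ∫ u in (-(1 : ℝ) / 2)..(1 / 2), Real.log (1 + u ^ 2 * 64 ^ 2) := by
    calc Real.log 4 = ∫ _ in (1 / 4 : ℝ)..(1 / 2), Real.log (4 ^ 4) := by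
          rw [intervalIntegral.integral_const, smul_eq_mul, Real.log_pow]
          push_cast
          ring
      _ ≤ ∫ u in (1 / 4 : ℝ)..(1 / 2), Real.log (1 + u ^ 2 * 64 ^ 2) := by
          refine intervalIntegral.integral_mono_on (by norm_num) intervalIntegrable_const
            ((hcont 64).intervalIntegrable _ _) fun u hu => ?_
          exact Real.log_le_log (by positivity) (by nlinarith [hu.1, hu.2])
      _ ≤ _ := by
          refine intervalIntegral.integral_mono_interval (by norm_num) (by norm_num) le_rfl
            (ae_of_all _ fun u => ?_) ((hcont 64).intervalIntegrable _ _)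
          exact Real.log_nonneg (le_add_of_nonneg_right (by positivity))
  obtain ⟨b, hb, hb'⟩ := intermediate_value_Icc (by norm_num : (1 : ℝ) ≤ 64)
    hparam.continuousOn ⟨hlow, hhigh⟩
  refine ⟨b⁻¹, inv_pos.2 (by linarith [hb.1]), ?_⟩
  simpa only [inv_pow, div_inv_eq_mul] using hb'

end UniformStrength

section Strength

variable {Ω : Type*} [MeasurableSpace Ω] {P : Measure Ω} {Y : Ω → ℝ}

lemma s1_const_mul_div {Δ : ℝ} (hΔ : 0 < Δ) :
    s1 P (fun ω => Δ * Y ω) / Δ = s1 P Y := by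
  have hset : {s : ℝ | 0 < s ∧ (∫ ω, Real.log (1 + (Δ * Y ω) ^ 2 / s ^ 2) ∂P) ≤ Real.log 4} =
      Δ • {s : ℝ | 0 < s ∧ (∫ ω, Real.log (1 + (Y ω) ^ 2 / s ^ 2) ∂P) ≤ Real.log 4} := by
    ext s
    rw [Set.mem_smul_set_iff_inv_smul_mem₀ hΔ.ne']
    have heq : ∀ y : ℝ, (Δ * y) ^ 2 / s ^ 2 = y ^ 2 / (Δ⁻¹ * s) ^ 2 := fun y => by
      rw [mul_pow, mul_pow, inv_pow, ← div_div, div_inv_eq_mul, mul_comm]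
    simp only [Set.mem_ofPred_eq, smul_eq_mul, heq, mul_pos_iff_of_pos_left (inv_pos.2 hΔ)]
  rw [s1, hset, Real.sInf_smul_of_nonneg hΔ.le, smul_eq_mul, mul_div_cancel_left₀ _ hΔ.ne', s1]

lemma s1_le {t : ℝ} (ht : 0 < t)
    (h : ∫ ω, Real.log (1 + (Y ω) ^ 2 / t ^ 2) ∂P ≤ Real.log 4) : s1 P Y ≤ t :=
  csInf_le ⟨0, fun _ hs => hs.1.le⟩ ⟨ht, h⟩

lemma le_s1 {t r : ℝ} (hr : 0 < r)
    (hint : ∀ s : ℝ, Integrable (fun ω => Real.log (1 + (Y ω) ^ 2 / s ^ 2)) P)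
    (h : Real.log 4 < ∫ ω, Real.log (1 + (Y ω) ^ 2 / r ^ 2) ∂P)
    (ht : 0 < t) (h' : ∫ ω, Real.log (1 + (Y ω) ^ 2 / t ^ 2) ∂P ≤ Real.log 4) :
    r ≤ s1 P Y := by
  refine le_csInf ⟨t, ht, h'⟩ fun s hs => ?_
  by_contra! hsr
  refine absurd (h.trans_le ?_) hs.2.not_gt
  have hs₀ := hs.1
  refine integral_mono (hint r) (hint s) fun ω => ?_
  exact Real.log_le_log (by positivity) (by gcongr)

end Strength

/-- High-rate performance of the uniform scalar quantizer under the CB-strength: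
if `X` has a density and `E[ln(1 + |X|)] < ∞`, and `X̂_Δ = Δ⌈X/Δ - 1/2⌉` is the
uniform quantization of step `Δ` (so the error `q_Δ = X - X̂_Δ` satisfies
`P(q_Δ ≠ 0) > 0`), then `s₁(q_Δ)/Δ → s₁(U)` as `Δ → 0⁺`, where `s₁(U)` is the unique
`s > 0` with `∫_{-1/2}^{1/2} ln(1 + u²/s²) du = ln 4`. -/
theorem uniform_quantizer_cb_strength {Ω : Type*} [MeasurableSpace Ω] (P : Measure Ω)
    [IsProbabilityMeasure P] (X : Ω → ℝ) (hX : Measurable X)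
    (hpdf : HasPDF X P volume)
    (hlog : Integrable (fun ω => Real.log (1 + |X ω|)) P) :
    (∀ Δ : ℝ, 0 < Δ → P {ω | X ω - Δ * (⌈X ω / Δ - 1 / 2⌉ : ℤ) ≠ 0} ≠ 0) ∧
    (∃! s : ℝ, 0 < s ∧
      (∫ u in (-(1 : ℝ) / 2)..(1 / 2), Real.log (1 + u ^ 2 / s ^ 2)) = Real.log 4) ∧
    ∀ s : ℝ, 0 < s →
      (∫ u in (-(1 : ℝ) / 2)..(1 / 2), Real.log (1 + u ^ 2 / s ^ 2)) = Real.log 4 →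
      Tendsto (fun Δ : ℝ =>
          s1 P (fun ω => X ω - Δ * (⌈X ω / Δ - 1 / 2⌉ : ℤ)) / Δ)
        (nhdsWithin 0 (Set.Ioi 0)) (nhds s) := by
  refine ⟨fun Δ hΔ h₀ => ?_, ?_, fun s hs hsL => ?_⟩
  · have hcount : (Set.range fun k : ℤ => Δ * (k : ℝ)).Countable := Set.countable_range _
    have h₁ : P (X ⁻¹' Set.range fun k : ℤ => Δ * (k : ℝ)) = 0 := by
      rw [← Measure.map_apply hX hcount.measurableSet]
      exact hpdf.absolutelyContinuous (hcount.measure_zero volume)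
    refine one_ne_zero (α := ENNReal) (le_antisymm ?_ zero_le)
    calc (1 : ENNReal) = P Set.univ := measure_univ.symm
      _ ≤ P ({ω | X ω - Δ * (⌈X ω / Δ - 1 / 2⌉ : ℤ) ≠ 0} ∪
            X ⁻¹' Set.range fun k : ℤ => Δ * (k : ℝ)) := by
          refine measure_mono fun ω _ => ?_
          by_cases hω : X ω - Δ * (⌈X ω / Δ - 1 / 2⌉ : ℤ) = 0
          · exact Or.inr ⟨_, (sub_eq_zero.1 hω).symm⟩
          · exact Or.inl hω
      _ ≤ 0 := (measure_union_le _ _).trans (by rw [h₀, h₁, add_zero])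
  · obtain ⟨s, hs, hsL⟩ := exists_integral_log_one_add_sq_div_sq_eq_log_four
    exact ⟨s, ⟨hs, hsL⟩, fun t ht => integral_log_one_add_sq_div_sq_strictAntiOn.injOn
      ht.1 hs (ht.2.trans hsL.symm)⟩
  · have hscale : ∀ Δ : ℝ, 0 < Δ →
        s1 P (fun ω => X ω - Δ * (⌈X ω / Δ - 1 / 2⌉ : ℤ)) / Δ =
          s1 P (fun ω => X ω / Δ - (⌈X ω / Δ - 1 / 2⌉ : ℤ)) := fun Δ hΔ => by
      rw [← s1_const_mul_div (Y := fun ω => X ω / Δ - (⌈X ω / Δ - 1 / 2⌉ : ℤ)) hΔ]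
      simp only [mul_sub, mul_div_cancel₀ _ hΔ.ne']
    have hupper : ∀ t, s < t → ∀ᶠ Δ in 𝓝[>] (0 : ℝ), ∫ ω, Real.log
        (1 + (X ω / Δ - (⌈X ω / Δ - 1 / 2⌉ : ℤ)) ^ 2 / t ^ 2) ∂P ≤ Real.log 4 := by
      intro t hst
      have hlt := integral_log_one_add_sq_div_sq_strictAntiOn hs (hs.trans hst) hst
      simp only [hsL] at hlt
      exact ((tendsto_integral_log_residue hX hpdf t).eventually_lt_const hlt).mono
        fun _ h => h.le
    have hpos : ∀ᶠ Δ in 𝓝[>] (0 : ℝ), 0 < Δ := self_mem_nhdsWithin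
    refine tendsto_order.2 ⟨fun a ha => ?_, fun a ha => ?_⟩
    · obtain ⟨r, hr, hrs⟩ := exists_between (max_lt ha hs)
      have hr₀ : 0 < r := (le_max_right _ _).trans_lt hr
      have hlt := integral_log_one_add_sq_div_sq_strictAntiOn hr₀ hs hrs
      simp only [hsL] at hlt
      filter_upwards [hpos, hupper (s + 1) (lt_add_one s),
        (tendsto_integral_log_residue hX hpdf r).eventually_const_lt hlt] with Δ hΔ hu hl
      rw [hscale Δ hΔ]
      exact ((le_max_left _ _).trans_lt hr).trans_le
        (le_s1 hr₀ (integrable_log_residue hX Δ) hl (by linarith) hu)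
    · obtain ⟨t, hst, hta⟩ := exists_between ha
      filter_upwards [hpos, hupper t hst] with Δ hΔ hu
      rw [hscale Δ hΔ]
      exact (s1_le (hs.trans hst) hu).trans_lt hta
end
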